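/- arXiv:math/0205087 — 3 statements merged into one kernel-verified Lean document; each statement's English description precedes it below -/
import Mathlib

section
/- For every integer n ≥ 1, δ20(𝔚_n) = −single_n(T_λ(u')) − Σ_{j=1}^{n−1} single_j(𝔘_{j−1}^{n−1}(t+λ) · T_λ(u')) − single_0(𝔘_0^{n−1} · (u' − u'(λ)) · T_λ(u)). (Lemma 2.2.7.) -/
open Polynomial

/-- `T μ P = P(t+μ) − P(t)`, the difference operator of Section 2.2 of
Guccione–Guccione, "Hochschild homology of iterated skew polynomial rings". -/
noncomputable def Tdiff {k : Type*} [Field k] (μ : k) (P : k[X]) : k[X] :=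
  P.comp (X + C μ) - P

open scoped Classical in
/-- `𝔘_j^n = (−1)^{n−j} Σ_{0 ≤ i₁ ≤ ⋯ ≤ i_{n−j} ≤ j+1} u(t+i₁λ)⋯u(t+i_{n−j}λ)`,
the sum running over weakly increasing sequences of `n−j` integers between `0`
and `j+1` (so `𝔘_n^n = 1`). -/
noncomputable def Ufrak {k : Type*} [Field k] (u : k[X]) (lam : k) (n : ℕ) (j : ℤ) : k[X] :=
  (-1) ^ (((n : ℤ) - j).toNat) *
    ∑ f ∈ Finset.univ.filter
        (fun f : Fin (((n : ℤ) - j).toNat) → Fin ((j + 2).toNat) => Monotone f),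
      ∏ l, u.comp (X + C (((f l : ℕ) : k) * lam))

/-- `𝔚_n = −(u'−u'(λ)) x^{n−1} y^n e₁ − Σ_{j=1}^{n−1} 𝔘_{j−1}^{n−1}(u'−u'(λ)) x^{j−1} y^j e₁`,
modelled in `ℕ →₀ k[t]`. -/
noncomputable def Wfrak {k : Type*} [Field k] (u : k[X]) (lam : k) (n : ℕ) :
    ℕ →₀ k[X] :=
  -Finsupp.single (n - 1) (derivative u - C ((derivative u).eval lam)) -
    ∑ j ∈ Finset.Icc 1 (n - 1),
      Finsupp.single (j - 1)
        (Ufrak u lam (n - 1) ((j : ℤ) - 1) *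
          (derivative u - C ((derivative u).eval lam)))

open scoped Classical in
/-- complete homogeneous sums in `a 0, …, a (r-1)` -/
noncomputable def Hsum {R : Type*} [CommRing R] (a : ℕ → R) (m r : ℕ) : R :=
  ∑ f ∈ Finset.univ.filter (fun f : Fin m → Fin r => Monotone f), ∏ l, a (f l : ℕ)

theorem Hsum_zero {R : Type*} [CommRing R] (a : ℕ → R) (r : ℕ) : Hsum a 0 r = 1 := by
  classical
  have : (Finset.univ.filter (fun f : Fin 0 → Fin r => Monotone f)) = Finset.univ := by
    apply Finset.filter_true_of_mem
    intro f _ x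
    exact x.elim0
  unfold Hsum
  simp [Subsingleton.monotone]

theorem Hsum_first {R : Type*} [CommRing R] (a : ℕ → R) (m r : ℕ) :
    Hsum a (m + 1) (r + 1) = a 0 * Hsum a m (r + 1) + Hsum (fun i => a (i + 1)) (m + 1) r := by
  classical
  unfold Hsum
  rw [← Finset.sum_filter_add_sum_filter_not _ (fun f : Fin (m+1) → Fin (r+1) => f 0 = 0)]
  congr 1
  · rw [Finset.mul_sum]
    symm
    apply Finset.sum_nbij (fun g => (Fin.cons 0 g : Fin (m+1) → Fin (r+1)))
    · intro g hg
      simp only [Finset.mem_filter, Finset.mem_univ, true_and] at hg ⊢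
      refine ⟨?_, rfl⟩
      intro x y hxy
      induction x using Fin.cases with
      | zero => simp
      | succ x =>
        induction y using Fin.cases with
        | zero => simp at hxy
        | succ y => simpa using hg (by simpa using hxy)
    · intro g _ g' _ h
      exact (Fin.cons_injective2 h).2
    · intro f hf
      simp only [Finset.coe_filter, Finset.mem_filter, Finset.mem_univ, true_and,
        Set.mem_ofPred_eq, Set.mem_image] at hf ⊢
      refine ⟨Fin.tail f, fun x y h => hf.1 (by simpa using h), ?_⟩
      rw [← hf.2]
      exact Fin.cons_self_tail f
    · intro g _
      simp [Fin.prod_univ_succ]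
  · symm
    apply Finset.sum_nbij (fun g l => (g l).succ)
    · intro g hg
      simp only [Finset.mem_filter, Finset.mem_univ, true_and] at hg ⊢
      refine ⟨fun x y h => by simpa using hg h, Fin.succ_ne_zero _⟩
    · intro g _ g' _ h
      funext l
      exact Fin.succ_injective _ (congrFun h l)
    · intro f hf
      simp only [Finset.coe_filter, Finset.mem_filter, Finset.mem_univ, true_and,
        Set.mem_ofPred_eq, Set.mem_image] at hf ⊢
      have hne : ∀ l, f l ≠ 0 := fun l h =>
        hf.2 (Fin.le_zero_iff.1 (h ▸ hf.1 (Fin.zero_le l)))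
      refine ⟨fun l => (f l).pred (hne l), fun x y h => by simpa using hf.1 h, ?_⟩
      funext l
      simp
    · intro g _
      simp

theorem Hsum_last {R : Type*} [CommRing R] (a : ℕ → R) (m r : ℕ) :
    Hsum a (m + 1) (r + 1) = a r * Hsum a m (r + 1) + Hsum a (m + 1) r := by
  classical
  unfold Hsum
  rw [← Finset.sum_filter_add_sum_filter_not _
    (fun f : Fin (m+1) → Fin (r+1) => f (Fin.last m) = Fin.last r)]
  congr 1
  · rw [Finset.mul_sum]
    symm
    apply Finset.sum_nbij (fun g => (Fin.snoc g (Fin.last r) : Fin (m+1) → Fin (r+1)))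
    · intro g hg
      simp only [Finset.mem_filter, Finset.mem_univ, true_and] at hg ⊢
      refine ⟨?_, by simp⟩
      intro x y hxy
      induction y using Fin.lastCases with
      | last => simpa using Fin.le_last _
      | cast y =>
        induction x using Fin.lastCases with
        | last => exact absurd hxy (by simp)
        | cast x => simpa using hg (by simpa using hxy)
    · intro g _ g' _ h
      funext l
      have := congrFun h l.castSucc
      simpa using this
    · intro f hf
      simp only [Finset.coe_filter, Finset.mem_filter, Finset.mem_univ, true_and,
        Set.mem_ofPred_eq, Set.mem_image] at hf ⊢
      refine ⟨Fin.init f, fun x y h => hf.1 (by simpa using h), ?_⟩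
      rw [← hf.2]
      exact Fin.snoc_init_self f
    · intro g _
      simp [Fin.prod_univ_castSucc, mul_comm]
  · symm
    apply Finset.sum_nbij (fun g l => (g l).castSucc)
    · intro g hg
      simp only [Finset.mem_filter, Finset.mem_univ, true_and] at hg ⊢
      refine ⟨fun x y h => by simpa using hg h, Fin.castSucc_ne_last _⟩
    · intro g _ g' _ h
      funext l
      exact Fin.castSucc_injective _ (congrFun h l)
    · intro f hf
      simp only [Finset.coe_filter, Finset.mem_filter, Finset.mem_univ, true_and,
        Set.mem_ofPred_eq, Set.mem_image] at hf ⊢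
      have hne : ∀ l, f l ≠ Fin.last r := fun l h =>
        hf.2 (Fin.last_le_iff.1 (h ▸ hf.1 (Fin.le_last l)))
      refine ⟨fun l => (f l).castPred (hne l), fun x y h => by simpa using hf.1 h, ?_⟩
      funext l
      simp
    · intro g _
      simp

theorem Ufrak_eq {k : Type*} [Field k] (u : k[X]) (lam : k) (m i : ℕ) :
    Ufrak u lam (i + m) (i : ℤ) =
      (-1) ^ m * Hsum (fun l => u.comp (X + C ((l : k) * lam))) m (i + 2) := by
  have h1 : (((i + m : ℕ) : ℤ) - i).toNat = m := by omega
  have h2 : ((i : ℤ) + 2).toNat = i + 2 := by omega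
  unfold Ufrak Hsum
  rw [h1, h2]

theorem Hsum_comp {k : Type*} [Field k] (u : k[X]) (lam : k) (m r : ℕ) :
    (Hsum (fun l => u.comp (X + C ((l : k) * lam))) m r).comp (X + C lam) =
      Hsum (fun l => u.comp (X + C (((l + 1 : ℕ) : k) * lam))) m r := by
  unfold Hsum
  rw [← Polynomial.coe_compRingHom_apply, map_sum]
  refine Finset.sum_congr rfl fun f _ => ?_
  rw [map_prod]
  refine Finset.prod_congr rfl fun l _ => ?_
  rw [Polynomial.coe_compRingHom_apply, Polynomial.comp_assoc]
  congr 1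
  simp
  ring

theorem Ufrak_self {k : Type*} [Field k] (u : k[X]) (lam : k) (n : ℕ) :
    Ufrak u lam n (n : ℤ) = 1 := by
  have := Ufrak_eq u lam 0 n
  simpa [Hsum_zero] using this

theorem Tdiff_Ufrak {k : Type*} [Field k] (u : k[X]) (lam : k) (N i : ℕ) (hi : i < N) :
    Tdiff lam (Ufrak u lam N (i : ℤ)) =
      -(Ufrak u lam N ((i + 1 : ℕ) : ℤ) * Tdiff ((((i + 1 : ℕ) : k) + 1) * lam) u) := by
  obtain ⟨m, rfl⟩ : ∃ m, N = i + 1 + m := ⟨N - (i + 1), by omega⟩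
  have e1 := Ufrak_eq u lam (m + 1) i
  rw [show i + (m + 1) = i + 1 + m by ring] at e1
  rw [e1, Ufrak_eq u lam m (i + 1)]
  unfold Tdiff
  have c : ((-1 : k[X]) ^ (m + 1)).comp (X + C lam) = (-1) ^ (m + 1) := by simp
  rw [Polynomial.mul_comp, c, Hsum_comp]
  have hf := Hsum_first (fun l => u.comp (X + C ((l : k) * lam))) m (i + 2)
  have hl := Hsum_last (fun l => u.comp (X + C ((l : k) * lam))) m (i + 2)
  have e0 : u.comp (X + C (((0 : ℕ) : k) * lam)) = u := by simp
  have e2 : (((i + 1 : ℕ) : k) + 1) = ((i + 2 : ℕ) : k) := by push_cast; ring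
  simp only [e0] at hf
  rw [e2, show i + 1 + 2 = i + 2 + 1 by ring]
  rw [pow_succ]
  linear_combination (-1 : k[X]) ^ m * (hf - hl)

/-- Lemma 2.2.7 of Guccione–Guccione: the value of the boundary map `δ₂₀` of
`W_{**}(E)` (on the summand `⊕_{i≥0} k[t]·x^i y^{i+1} e₁`, modelled as
`ℕ →₀ k[t]`) on the element `𝔚_n`. -/
theorem stmt15 {k : Type*} [Field k] [CharZero k] (lam : k) (hlam : lam ≠ 0)
    (u : k[X])
    (D : (ℕ →₀ k[X]) →ₗ[k] (ℕ →₀ k[X]))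
    (hD : ∀ (i : ℕ) (P : k[X]),
      D (Finsupp.single i P) =
        Finsupp.single (i + 1) (Tdiff lam P) +
          Finsupp.single i (P * Tdiff (((i : k) + 1) * lam) u)) :
    ∀ n : ℕ, 1 ≤ n →
      D (Wfrak u lam n) =
        -Finsupp.single n (Tdiff lam (derivative u)) -
          (∑ j ∈ Finset.Icc 1 (n - 1),
            Finsupp.single j
              ((Ufrak u lam (n - 1) ((j : ℤ) - 1)).comp (X + C lam) *
                Tdiff lam (derivative u))) -
          Finsupp.single 0
            (Ufrak u lam (n - 1) 0 *
              (derivative u - C ((derivative u).eval lam)) * Tdiff lam u) := by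
  intro n hn
  obtain ⟨N, rfl⟩ : ∃ N, n = N + 1 := ⟨n - 1, by omega⟩
  simp only [Nat.add_sub_cancel]
  have reidx : ∀ F : ℕ → (ℕ →₀ k[X]), ∑ j ∈ Finset.Icc 1 N, F j =
      ∑ i ∈ Finset.range N, F (i + 1) := by
    intro F
    rw [Finset.range_eq_Ico, Finset.sum_Ico_add' F 0 N 1]
    rfl
  unfold Wfrak
  simp only [Nat.add_sub_cancel]
  rw [reidx, reidx]
  have cast1 : ∀ i : ℕ, (((i + 1 : ℕ) : ℤ) - 1) = (i : ℤ) := by intro i; push_cast; ring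
  simp only [cast1, Nat.add_sub_cancel]
  set v := derivative u - C ((derivative u).eval lam) with hv
  have hTv : Tdiff lam (derivative u) = Tdiff lam v := by
    simp [Tdiff, hv]
  rw [hTv]
  have hmul : ∀ P : k[X], Tdiff lam (P * v) =
      P.comp (X + C lam) * Tdiff lam v + Tdiff lam P * v := by
    intro P
    simp only [Tdiff, Polynomial.mul_comp]
    ring
  -- telescoping
  have key : ∀ M ≤ N, ∑ i ∈ Finset.range M, D (Finsupp.single i (Ufrak u lam N (i : ℤ) * v)) =
      ∑ i ∈ Finset.range M, Finsupp.single (i + 1)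
        ((Ufrak u lam N (i : ℤ)).comp (X + C lam) * Tdiff lam v) +
      Finsupp.single 0 (Ufrak u lam N 0 * v * Tdiff lam u) -
      Finsupp.single M (Ufrak u lam N (M : ℤ) * v * Tdiff (((M : k) + 1) * lam) u) := by
    intro M
    induction M with
    | zero => intro _; simp
    | succ M ih =>
      intro hM
      rw [Finset.sum_range_succ, Finset.sum_range_succ, ih (by omega), hD, hmul,
        Tdiff_Ufrak u lam N M (by omega), Finsupp.single_add]
      rw [show -(Ufrak u lam N ((M + 1 : ℕ) : ℤ) * Tdiff ((((M + 1 : ℕ) : k) + 1) * lam) u) * v =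
        -(Ufrak u lam N ((M + 1 : ℕ) : ℤ) * v * Tdiff ((((M + 1 : ℕ) : k) + 1) * lam) u) by ring,
        Finsupp.single_neg]
      abel
  rw [map_sub, map_neg, map_sum, key N le_rfl, hD, Ufrak_self, one_mul]
  abel
end

section
/- For every integer n ≥ 0, the element −single_n(T_λ(u')) − Σ_{j=0}^{n−1} single_j(𝔘_{j−1}^{n−1}(t+λ) · T_λ(u')) + single_0((−1)^n · (T_λ(u^n · u') − u'(λ) · T_λ(u^n))) of (ℕ →₀ k[t]) lies in the image of δ20. (This is the computation, in the proof of Theorem 2.2.8, identifying the induced map φ̄₁ with the map Ψ given by Ψ(𝔙_n) = (−1)^n · [T_λ(u^n u')]: modulo the image of δ_{20}, the class of φ₁(𝔙_n) in ⊕ A x^i y^i is represented by ±(T_λ(u^n u') − u'(λ) T_λ(u^n)) x^0 y^0.) -/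
open Polynomial

/-- complete homogeneous polynomials of degree `m` in `a 0, …, a (p-1)`. -/
def chom {R : Type*} [CommRing R] (a : ℕ → R) : ℕ → ℕ → R
  | 0, _ => 1
  | _ + 1, 0 => 0
  | m + 1, p + 1 => chom a (m + 1) p + a p * chom a m (p + 1)

theorem chom_zero {R : Type*} [CommRing R] (a : ℕ → R) (p : ℕ) : chom a 0 p = 1 := by
  cases p <;> simp [chom]

theorem chom_succ' {R : Type*} [CommRing R] (a : ℕ → R) (m p : ℕ) :
    chom a (m + 1) (p + 1) = chom (fun i => a (i + 1)) (m + 1) p + a 0 * chom a m (p + 1) := by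
  induction m generalizing p with
  | zero =>
    induction p with
    | zero => simp [chom]
    | succ p ih =>
      have h1 := chom.eq_3 a 0 (p + 1)
      have h2 := chom.eq_3 (fun i => a (i + 1)) 0 p
      simp only [chom_zero, Nat.succ_eq_add_one] at h1 h2 ih ⊢
      linear_combination h1 - h2 + ih
  | succ m ihm =>
    induction p with
    | zero => simp [chom]
    | succ p ih =>
      have h1 := chom.eq_3 a (m + 1) (p + 1)
      have h2 := chom.eq_3 (fun i => a (i + 1)) (m + 1) p
      have h3 := chom.eq_3 a m (p + 1)
      have h4 := ihm (p + 1)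
      simp only [Nat.succ_eq_add_one] at h1 h2 h3 h4 ih ⊢
      linear_combination h1 - h2 + ih + a (p + 1) * h4 - a 0 * h3

theorem chom_diff {R : Type*} [CommRing R] (a : ℕ → R) (m p : ℕ) :
    chom (fun i => a (i + 1)) (m + 1) (p + 1) - chom a (m + 1) (p + 1)
      = (a (p + 1) - a 0) * chom a m (p + 2) := by
  have h1 := chom_succ' a m (p + 1)
  have h2 := chom.eq_3 a m (p + 1)
  linear_combination h2 - h1

open scoped Classical in
theorem sum_mono_eq_chom {R : Type*} [CommRing R] (a : ℕ → R) (m p : ℕ) :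
    ∑ f ∈ Finset.univ.filter (fun f : Fin m → Fin p => Monotone f), ∏ l, a (f l : ℕ)
      = chom a m p := by
  induction m generalizing p with
  | zero =>
    rw [chom_zero, Finset.filter_true_of_mem]
    · simp
    · intro f _ i; exact i.elim0
  | succ m ihm =>
    induction p with
    | zero =>
      rw [chom]
      apply Finset.sum_eq_zero
      intro f _
      exact (f 0).elim0
    | succ p ihp =>
      rw [chom, ← ihp, ← ihm,
        ← Finset.sum_filter_not_add_sum_filter _
          (fun f : Fin (m + 1) → Fin (p + 1) => f (Fin.last m) = Fin.last p)]
      congr 1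
      · symm
        apply Finset.sum_bij (fun (g : Fin (m + 1) → Fin p) _ => fun l => (g l).castSucc)
        · intro g hg
          simp only [Finset.mem_filter, Finset.mem_univ, true_and] at hg ⊢
          refine ⟨fun i j hij => ?_, ?_⟩
          · exact Fin.castSucc_le_castSucc_iff.2 (hg hij)
          · exact (Fin.castSucc_lt_last _).ne
        · intro g _ g' _ h
          funext l
          exact Fin.castSucc_injective _ (congrFun h l)
        · intro f hf
          simp only [Finset.mem_filter, Finset.mem_univ, true_and] at hf
          have hne : ∀ l, f l ≠ Fin.last p := by
            intro l hl
            apply hf.2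
            apply le_antisymm (Fin.le_last _)
            rw [← hl]; exact hf.1 (Fin.le_last l)
          refine ⟨fun l => (f l).castPred (hne l), ?_, ?_⟩
          · simp only [Finset.mem_filter, Finset.mem_univ, true_and]
            intro i j hij
            exact hf.1 hij
          · funext l; simp
        · intro g _; simp
      · symm
        rw [Finset.mul_sum]
        apply Finset.sum_bij (fun (g : Fin m → Fin (p + 1)) _ =>
          (Fin.snoc g (Fin.last p) : Fin (m + 1) → Fin (p + 1)))
        · intro g hg
          simp only [Finset.mem_filter, Finset.mem_univ, true_and] at hg ⊢
          refine ⟨fun i j hij => ?_, by simp⟩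
          induction j using Fin.lastCases with
          | last => simpa using Fin.le_last _
          | cast j =>
            induction i using Fin.lastCases with
            | last => exact absurd hij (not_le.2 (Fin.castSucc_lt_last j))
            | cast i => simpa using hg (Fin.castSucc_le_castSucc_iff.1 hij)
        · intro g _ g' _ h
          funext l
          simpa using congrFun h l.castSucc
        · intro f hf
          simp only [Finset.mem_filter, Finset.mem_univ, true_and] at hf
          refine ⟨fun l => f l.castSucc, ?_, ?_⟩
          · simp only [Finset.mem_filter, Finset.mem_univ, true_and]
            intro i j hij
            exact hf.1 (Fin.castSucc_le_castSucc_iff.2 hij)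
          · funext l
            induction l using Fin.lastCases with
            | last => simp [hf.2]
            | cast l => simp
        · intro g _
          rw [Fin.prod_univ_castSucc]; simp [mul_comm]

theorem chom_map {R S : Type*} [CommRing R] [CommRing S] (φ : R →+* S) (a : ℕ → R) (m p : ℕ) :
    φ (chom a m p) = chom (fun i => φ (a i)) m p := by
  induction m generalizing p with
  | zero => simp [chom_zero]
  | succ m ihm =>
    induction p with
    | zero => simp [chom]
    | succ p ihp => rw [chom, chom, map_add, map_mul, ihp, ihm]

/-- shifts of `u`. -/
noncomputable def ush {k : Type*} [Field k] (u : k[X]) (lam : k) (i : ℕ) : k[X] :=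
  u.comp (X + C ((i : k) * lam))

theorem ush_comp {k : Type*} [Field k] (u : k[X]) (lam : k) (i : ℕ) :
    (ush u lam i).comp (X + C lam) = ush u lam (i + 1) := by
  simp only [ush, comp_assoc]
  congr 1
  simp
  ring

theorem chom_comp {k : Type*} [Field k] (u : k[X]) (lam : k) (m p : ℕ) :
    (chom (ush u lam) m p).comp (X + C lam) = chom (fun i => ush u lam (i + 1)) m p := by
  have := chom_map (compRingHom (X + C lam)) (ush u lam) m p
  simpa [ush_comp] using this

theorem Ufrak_eq_s17 {k : Type*} [Field k] (u : k[X]) (lam : k) (n j : ℕ) (hj : j < n) :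
    Ufrak u lam (n - 1) ((j : ℤ) - 1) = (-1) ^ (n - j) * chom (ush u lam) (n - j) (j + 1) := by
  have h1 : (((n - 1 : ℕ) : ℤ) - ((j : ℤ) - 1)).toNat = n - j := by omega
  have h2 : ((j : ℤ) - 1 + 2).toNat = j + 1 := by omega
  unfold Ufrak
  rw [h1, h2, ← sum_mono_eq_chom]
  rfl

/-- The computation in the proof of Theorem 2.2.8 of Guccione–Guccione
identifying `φ̄₁` with `Ψ`: modulo the image of `δ₂₀`, the element
`−T_λ(u') x^n y^n − Σ_{j=0}^{n−1} 𝔘_{j−1}^{n−1}(t+λ) T_λ(u') x^j y^j`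
is congruent to `(−1)^{n+1}(T_λ(u^n u') − u'(λ) T_λ(u^n)) x⁰y⁰`. -/
theorem stmt17 {k : Type*} [Field k] [CharZero k] (lam : k) (hlam : lam ≠ 0)
    (u : k[X])
    (D : (ℕ →₀ k[X]) →ₗ[k] (ℕ →₀ k[X]))
    (hD : ∀ (i : ℕ) (P : k[X]),
      D (Finsupp.single i P) =
        Finsupp.single (i + 1) (Tdiff lam P) +
          Finsupp.single i (P * Tdiff (((i : k) + 1) * lam) u)) :
    ∀ n : ℕ,
      (-Finsupp.single n (Tdiff lam (derivative u)) -
          (∑ j ∈ Finset.range n,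
            Finsupp.single j
              ((Ufrak u lam (n - 1) ((j : ℤ) - 1)).comp (X + C lam) *
                Tdiff lam (derivative u))) +
          Finsupp.single 0
            ((-1) ^ n *
              (Tdiff lam (u ^ n * derivative u) -
                C ((derivative u).eval lam) * Tdiff lam (u ^ n)))) ∈
        LinearMap.range D := by
  intro n
  set w : k[X] := derivative u - C ((derivative u).eval lam) with hw
  set a := ush u lam with ha
  have ha0 : a 0 = u := by simp [ha, ush]
  have hTw : Tdiff lam (derivative u) = Tdiff lam w := by
    simp [hw, Tdiff]
  have hT : ∀ i : ℕ, Tdiff (((i : k) + 1) * lam) u = a (i + 1) - a 0 := by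
    intro i; rw [ha0]; simp [ha, ush, Tdiff]
  have hpow : ∀ m : ℕ, chom a m 1 = u ^ m := by
    intro m
    induction m with
    | zero => simp [chom]
    | succ m ih => rw [chom, ih, chom, ha0]; ring
  let B : ℕ → k[X] := fun j => (-1) ^ (n - j) * chom a (n - j) (j + 1) * w
  have key : ∀ j ∈ Finset.range n,
      D (Finsupp.single j (-B (j + 1))) =
      (Finsupp.single j (Tdiff lam (B j)) - Finsupp.single (j + 1) (Tdiff lam (B (j + 1))))
       - Finsupp.single j ((Ufrak u lam (n - 1) ((j : ℤ) - 1)).comp (X + C lam) *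
                Tdiff lam (derivative u)) := by
    intro j hj
    have hjn := Finset.mem_range.1 hj
    obtain ⟨m, rfl⟩ : ∃ m, n = j + 1 + m := ⟨n - (j + 1), by omega⟩
    have e1 : j + 1 + m - j = m + 1 := by omega
    have e2 : j + 1 + m - (j + 1) = m := by omega
    have hneg : Tdiff lam (-B (j + 1)) = -Tdiff lam (B (j + 1)) := by
      simp [Tdiff]; ring
    rw [hD, hneg, hT, Ufrak_eq_s17 u lam _ j hjn, hTw, Finsupp.single_neg]
    have hc : -B (j + 1) * (a (j + 1) - a 0) = Tdiff lam (B j) -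
        ((-1) ^ (j + 1 + m - j) * chom (ush u lam) (j + 1 + m - j) (j + 1)).comp (X + C lam)
          * Tdiff lam w := by
      have hd := chom_diff a m j
      simp only [B, e1, e2, Tdiff, mul_comp, pow_comp, neg_comp, one_comp, ← ha]
      rw [ha, chom_comp, ← ha]
      linear_combination (-1) ^ m * w * hd
    rw [hc, Finsupp.single_sub]
    abel
  refine ⟨∑ j ∈ Finset.range n, Finsupp.single j (-B (j + 1)), ?_⟩
  rw [map_sum, Finset.sum_congr rfl key, Finset.sum_sub_distrib,
    Finset.sum_range_sub' (fun j => Finsupp.single j (Tdiff lam (B j)))]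
  have hBn : B n = w := by simp [B, chom_zero]
  have hB0 : Tdiff lam (B 0) = (-1) ^ n *
              (Tdiff lam (u ^ n * derivative u) -
                C ((derivative u).eval lam) * Tdiff lam (u ^ n)) := by
    simp only [B, Nat.sub_zero, zero_add, hpow, hw, Tdiff, mul_comp, pow_comp, neg_comp, one_comp,
      sub_comp, C_comp]
    ring
  rw [hBn, hB0, hTw]
  abel
end

section
/- Assume u ∈ k (u is a constant polynomial). Then the kernel of δ10 equals {L ∈ (ℕ →₀ k[t]) : L(i) is a constant polynomial for every i ∈ ℕ}, and the image of δ10 equals {L ∈ (ℕ →₀ k[t]) : L(0) = 0}. (The kernel and image computations underlying Proposition 2.2.2, where the homology of the row W_{*0}(E) is computed in the case u ∈ k.) -/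
open Polynomial

theorem Tdiff_add' {k : Type*} [Field k] (μ : k) (P Q : k[X]) :
    Tdiff μ (P + Q) = Tdiff μ P + Tdiff μ Q := by
  simp only [Tdiff, add_comp]; ring

theorem Tdiff_C_mul' {k : Type*} [Field k] (μ a : k) (P : k[X]) :
    Tdiff μ (C a * P) = C a * Tdiff μ P := by
  simp only [Tdiff, mul_comp, C_comp]; ring

theorem Tdiff_C' {k : Type*} [Field k] (μ a : k) :
    Tdiff μ (C a) = 0 := by
  simp [Tdiff]

theorem Tdiff_ker {k : Type*} [Field k] [CharZero k] (lam : k) (hlam : lam ≠ 0) (P : k[X])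
    (h : Tdiff lam P = 0) : ∃ c : k, P = C c := by
  refine ⟨P.eval 0, ?_⟩
  have h1 : P.comp (X + C lam) = P := sub_eq_zero.mp h
  have h2 : ∀ n : ℕ, P.eval ((n : k) * lam) = P.eval 0 := by
    intro n
    induction n with
    | zero => simp
    | succ n ih =>
      rw [← ih]
      conv_rhs => rw [← h1]
      simp [add_mul]
  refine Polynomial.eq_of_infinite_eval_eq _ _ ?_
  refine Set.Infinite.mono (s := Set.range fun n : ℕ => (n : k) * lam) ?_ ?_
  · rintro _ ⟨n, rfl⟩
    simpa using h2 n
  · refine Set.infinite_range_of_injective ?_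
    intro a b hab
    exact Nat.cast_injective (mul_right_cancel₀ hlam hab)

theorem Tdiff_surj {k : Type*} [Field k] [CharZero k] (lam : k) (hlam : lam ≠ 0) (Q : k[X]) :
    ∃ P, Tdiff lam P = Q := by
  induction Q using Polynomial.induction_on' with
  | add p q hp hq =>
    obtain ⟨a, rfl⟩ := hp
    obtain ⟨b, rfl⟩ := hq
    exact ⟨a + b, Tdiff_add' _ _ _⟩
  | monomial n a =>
    have hB := congrArg (Polynomial.map (algebraMap ℚ k))
      (Polynomial.bernoulli_comp_one_add_X (n + 1))
    set B : k[X] := (Polynomial.bernoulli (n + 1)).map (algebraMap ℚ k) with hBdef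
    have hB' : B.comp (1 + X) = B + C ((n : k) + 1) * X ^ n := by
      rw [Polynomial.map_comp] at hB
      simpa [nsmul_eq_mul] using hB
    have key : Tdiff lam (B.comp (C lam⁻¹ * X)) = C (((n : k) + 1) * lam⁻¹ ^ n) * X ^ n := by
      have e : (C lam⁻¹ * X : k[X]).comp (X + C lam) = (1 + X : k[X]).comp (C lam⁻¹ * X) := by
        simp only [mul_comp, C_comp, X_comp, add_comp, one_comp, mul_add, ← C_mul,
          inv_mul_cancel₀ hlam, C_1]
        ring
      rw [Tdiff, comp_assoc, e, ← comp_assoc, hB']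
      simp [mul_pow, -map_inv₀, -inv_pow, C_pow]
      ring
    refine ⟨C (a * (((n : k) + 1) * lam⁻¹ ^ n)⁻¹) * B.comp (C lam⁻¹ * X), ?_⟩
    have hn : ((n : k) + 1) * lam⁻¹ ^ n ≠ 0 :=
      mul_ne_zero (Nat.cast_add_one_ne_zero n) (pow_ne_zero _ (inv_ne_zero hlam))
    rw [Tdiff_C_mul', key, ← mul_assoc, ← C_mul, mul_assoc, inv_mul_cancel₀ hn, mul_one,
      C_mul_X_pow_eq_monomial]

/-- The kernel and image computations underlying Proposition 2.2.2 of
Guccione–Guccione: if `u ∈ k` is constant, then the kernel of the boundary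
map `δ₁₀` of `W_{**}(E)` consists of the elements all of whose components are
constant polynomials, and its image consists of the elements whose component
of degree `x⁰y⁰` vanishes. -/
theorem stmt18 {k : Type*} [Field k] [CharZero k] (lam : k) (hlam : lam ≠ 0)
    (u : k[X]) (hu : ∃ c : k, u = C c)
    (D : (ℕ →₀ k[X]) →ₗ[k] (ℕ →₀ k[X]))
    (hD : ∀ (j : ℕ) (Q : k[X]),
      D (Finsupp.single j Q) =
        -Finsupp.single (j + 1) (Tdiff lam Q) -
          Finsupp.single j (Q * Tdiff (((j : k) + 1) * lam) u)) :
    (∀ L : ℕ →₀ k[X], D L = 0 ↔ ∀ i : ℕ, ∃ c : k, L i = C c) ∧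
      ∀ L : ℕ →₀ k[X], (∃ M : ℕ →₀ k[X], D M = L) ↔ L 0 = 0 := by
  obtain ⟨c, rfl⟩ := hu
  have hD' : ∀ (j : ℕ) (Q : k[X]),
      D (Finsupp.single j Q) = -Finsupp.single (j + 1) (Tdiff lam Q) := by
    intro j Q
    rw [hD, Tdiff_C']
    simp
  have h0 : ∀ L : ℕ →₀ k[X], D L 0 = 0 := by
    intro L
    induction L using Finsupp.induction_linear with
    | zero => simp
    | add f g hf hg => simp [hf, hg]
    | single j Q => simp [hD']
  have hs : ∀ (L : ℕ →₀ k[X]) (i : ℕ), D L (i + 1) = -Tdiff lam (L i) := by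
    intro L i
    induction L using Finsupp.induction_linear with
    | zero => simp [Tdiff]
    | add f g hf hg =>
      rw [map_add D f g, Finsupp.add_apply, hf, hg, Finsupp.add_apply, Tdiff_add']
      ring
    | single j Q =>
      rw [hD', Finsupp.neg_apply]
      by_cases h : j = i
      · subst h; simp
      · simp [Finsupp.single_apply, h, Tdiff]
  refine ⟨fun L => ⟨fun h i => ?_, fun h => ?_⟩, fun L => ⟨?_, fun h => ?_⟩⟩
  · apply Tdiff_ker lam hlam
    have := hs L i
    rw [h] at this
    simpa using this.symm
  · ext1 i
    cases i with
    | zero => simp [h0]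
    | succ i =>
      obtain ⟨c, hc⟩ := h i
      rw [hs, hc, Tdiff_C']
      simp
  · rintro ⟨M, rfl⟩
    exact h0 M
  · have hex : ∀ L : ℕ →₀ k[X], ∃ M : ℕ →₀ k[X], ∀ i, D M (i + 1) = L (i + 1) := by
      intro L
      induction L using Finsupp.induction_linear with
      | zero => exact ⟨0, by simp⟩
      | add f g hf hg =>
        obtain ⟨a, ha⟩ := hf
        obtain ⟨b, hb⟩ := hg
        exact ⟨a + b, fun i => by simp [ha, hb]⟩
      | single j Q =>
        cases j with
        | zero => exact ⟨0, fun i => by simp⟩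
        | succ j =>
          obtain ⟨P, hP⟩ := Tdiff_surj lam hlam (-Q)
          refine ⟨Finsupp.single j P, fun i => ?_⟩
          rw [hD', hP]
          simp
    obtain ⟨M, hM⟩ := hex L
    refine ⟨M, ?_⟩
    ext1 i
    cases i with
    | zero => rw [h0, h]
    | succ i => exact hM i
end
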